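/- arXiv:2510.18529 — 4 statements merged into one kernel-verified Lean document; each statement's English description precedes it below -/
import Mathlib

section
/- Let p, q ≥ 3 be prime numbers. Then t(pq) ≥ pq − 5. -/
/-- `cyc σ` is the number of cycles in the cycle decomposition of the permutation `σ`,
counting fixed points as cycles; i.e., the number of orbits of `σ`. -/
noncomputable def cyc {α : Type*} (σ : Equiv.Perm α) : ℕ :=
  Nat.card (Quotient (Setoid.mk σ.SameCycle
    ⟨fun x => Equiv.Perm.SameCycle.refl σ x, fun h => h.symm, fun h h' => h.trans h'⟩))

/-- `t(π) = n - cyc(π)`, the minimum number of transpositions whose product is `π`. -/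
noncomputable def tPerm {n : ℕ} (π : Equiv.Perm (ZMod n)) : ℕ := n - cyc π

/-- `t([π])`, the minimum of `t(π ∘ c^k)` over `k ∈ ℤ_n`, where `c : x ↦ x + 1`. -/
noncomputable def tCoset {n : ℕ} (π : Equiv.Perm (ZMod n)) : ℕ :=
  sInf { m : ℕ | ∃ k : ZMod n, m = tPerm (π * Equiv.addRight k) }

/-- The circular sorting number `t(n)`, the maximum of `t([π])` over `π ∈ S(ℤ_n)`. -/
noncomputable def tCirc (n : ℕ) : ℕ :=
  sSup { m : ℕ | ∃ π : Equiv.Perm (ZMod n), m = tCoset π }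

theorem Setoid.rel_smul_zpow {G α : Type*} [Group G] [MulAction G α] (r : Setoid α) (u : G)
    (h : ∀ x, r x (u • x)) (k : ℤ) (x : α) : r x (u ^ k • x) := by
  have key : ∀ (n : ℕ) (x : α), r x (u ^ n • x) := by
    intro n
    induction n with
    | zero => intro x; simp
    | succ n ih => intro x; rw [pow_succ', mul_smul]; exact r.trans (ih x) (h _)
  obtain ⟨n, rfl | rfl⟩ := k.eq_nat_or_neg
  · simpa using key n x
  · simpa using r.symm (key n (u ^ (-(n : ℤ)) • x))

/-- An affine map of `ZMod p` with multiplier `γ ^ a`, where `γ` is a primitive root, has at most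
`1 + gcd a (p - 1)` orbits. -/
theorem exists_transversal_affine {p : ℕ} [Fact p.Prime] (γ : (ZMod p)ˣ)
    (hγ : ∀ w, w ∈ Subgroup.zpowers γ) (a : ℤ) (t : ZMod p) (r : Setoid (ZMod p))
    (hr : ∀ x, r x (((γ ^ a : (ZMod p)ˣ) : ZMod p) * x + t)) :
    ∃ S : Finset (ZMod p), S.card ≤ 1 + Int.gcd a (p - 1) ∧ ∀ x, ∃ s ∈ S, r s x := by
  classical
  have hp1 : 1 ≤ p := (Fact.out : p.Prime).one_lt.le
  have hord : orderOf γ = p - 1 := by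
    rw [orderOf_eq_card_of_forall_mem_zpowers hγ, Nat.card_eq_fintype_card, ZMod.card_units]
  by_cases hu : γ ^ a = 1
  · refine ⟨Finset.univ, ?_, fun x => ⟨x, Finset.mem_univ _, r.refl x⟩⟩
    have h1 : ((p - 1 : ℕ) : ℤ) ∣ a := hord ▸ orderOf_dvd_iff_zpow_eq_one.2 hu
    push_cast [hp1] at h1
    rw [Int.gcd_eq_natAbs_right h1, Finset.card_univ, ZMod.card]
    omega
  · set u : ZMod p := ((γ ^ a : (ZMod p)ˣ) : ZMod p) with hu_def
    have h1 : 1 - u ≠ 0 := fun h => hu (Units.ext (sub_eq_zero.1 h).symm)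
    set x₀ := t / (1 - u) with hx₀
    have hfix : u * x₀ + t = x₀ := by rw [hx₀]; field_simp; ring
    let r' : Setoid (ZMod p) := r.comap (x₀ + ·)
    have hr' : ∀ w : ZMod p, r' w ((γ ^ a) • w) := by
      intro w
      have := hr (x₀ + w)
      have e : u * (x₀ + w) + t = x₀ + (γ ^ a) • w := by
        rw [Units.smul_def, smul_eq_mul, ← hu_def]; linear_combination hfix
      rwa [e] at this
    set d := Int.gcd a (p - 1) with hd
    have hdpos : 0 < d := Int.gcd_pos_of_ne_zero_right _ (by
      have := (Fact.out : p.Prime).one_lt; omega)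
    refine ⟨insert x₀ ((Finset.range d).image fun i => x₀ + ((γ ^ i : (ZMod p)ˣ) : ZMod p)), ?_, ?_⟩
    · refine (Finset.card_insert_le _ _).trans ?_
      have := (Finset.card_image_le (s := Finset.range d)
        (f := fun i => x₀ + ((γ ^ i : (ZMod p)ˣ) : ZMod p)))
      rw [Finset.card_range] at this
      omega
    · intro x
      by_cases hx : x = x₀
      · exact ⟨x₀, by simp, hx ▸ r.refl x⟩
      obtain ⟨n, hn⟩ := hγ (Units.mk0 (x - x₀) (sub_ne_zero.2 hx))
      have hmod := Int.emod_nonneg n (b := (d : ℤ)) (by omega)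
      have hlt := Int.emod_lt_of_pos n (b := (d : ℤ)) (by omega)
      refine ⟨x₀ + ((γ ^ (n % d).toNat : (ZMod p)ˣ) : ZMod p), ?_, ?_⟩
      · refine Finset.mem_insert_of_mem (Finset.mem_image.2 ⟨_, ?_, rfl⟩)
        rw [Finset.mem_range]; omega
      · have h2 := r'.rel_smul_zpow (γ ^ a) hr' (Int.gcdA a (p - 1) * (n / d))
          ((γ ^ (n % d).toNat : (ZMod p)ˣ) : ZMod p)
        have hγ1 : γ ^ ((p : ℤ) - 1) = 1 := by
          rw [← orderOf_dvd_iff_zpow_eq_one, hord]; push_cast [hp1]; exact dvd_rfl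
        have e : (γ ^ a) ^ (Int.gcdA a (p - 1) * (n / d)) * γ ^ (n % d).toNat = γ ^ n := by
          have hb := Int.gcd_eq_gcd_ab a (p - 1)
          rw [← hd] at hb
          have hn' := Int.mul_ediv_add_emod n d
          rw [← zpow_natCast γ, Int.toNat_of_nonneg hmod, ← zpow_mul, ← zpow_add]
          have : n = (a * (Int.gcdA a (p - 1) * (n / d)) + n % d)
              + (p - 1) * (Int.gcdB a (p - 1) * (n / d)) := by
            linear_combination (-1 : ℤ) * hn' + (n / d) * hb
          conv_rhs => rw [this, zpow_add, zpow_mul γ (p - 1), hγ1, one_zpow, mul_one]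
        rw [Units.smul_def, smul_eq_mul, ← Units.val_mul, e] at h2
        have e2 : x₀ + ((γ ^ n : (ZMod p)ˣ) : ZMod p) = x := by
          have : γ ^ n = Units.mk0 (x - x₀) (sub_ne_zero.2 hx) := hn
          rw [this]; simp
        have h3 : r (x₀ + _) (x₀ + _) := h2
        rwa [e2] at h3

theorem sum_range_pow_eq_sum_sub {p : ℕ} [Fact p.Prime] (β : (ZMod p)ˣ)
    (hβ : ∀ w, w ∈ Subgroup.zpowers β) (f : ZMod p → ℤ) :
    ∑ l ∈ Finset.range (p - 1), f ((β ^ l : (ZMod p)ˣ) : ZMod p) = ∑ z, f z - f 0 := by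
  classical
  have hord : orderOf β = p - 1 := by
    rw [orderOf_eq_card_of_forall_mem_zpowers hβ, Nat.card_eq_fintype_card, ZMod.card_units]
  have himg : (Finset.range (p - 1)).image (fun l => ((β ^ l : (ZMod p)ˣ) : ZMod p))
      = Finset.univ.erase 0 := by
    ext z
    simp only [Finset.mem_image, Finset.mem_erase, Finset.mem_univ, and_true]
    constructor
    · rintro ⟨l, -, rfl⟩
      exact Units.ne_zero _
    · intro hz
      have h := Finset.mem_univ (Units.mk0 z hz)
      rw [← IsCyclic.image_range_orderOf hβ, hord, Finset.mem_image] at h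
      obtain ⟨l, hl, h⟩ := h
      exact ⟨l, hl, by rw [h]; rfl⟩
  rw [← Finset.sum_erase_eq_sub (Finset.mem_univ 0), ← himg, Finset.sum_image]
  intro a ha b hb hab
  simp only [Finset.coe_range, ← hord] at ha hb
  exact pow_injOn_Iio_orderOf ha hb (Units.ext hab)

/-- The skew product `(y, x) ↦ (β y, γ ^ e(y) x)` composed with any translation has at most five
orbits: those over the fixed point of the base map, and those over its unique other cycle, on which
the return map is affine with multiplier `γ ^ (∑ w, e w - e z)`. -/
theorem exists_transversal_skew {p q : ℕ} [Fact p.Prime] [Fact q.Prime] (hp3 : 3 ≤ p)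
    (β : (ZMod p)ˣ) (hβ : ∀ w, w ∈ Subgroup.zpowers β)
    (γ : (ZMod q)ˣ) (hγ : ∀ w, w ∈ Subgroup.zpowers γ) (e : ZMod p → ℤ)
    (he : ∀ z, Int.gcd (e z) (q - 1) + Int.gcd (∑ w, e w - e z) (q - 1) ≤ 3)
    (j : ZMod p) (i : ZMod q) (r : Setoid (ZMod p × ZMod q))
    (hr : ∀ y x, r (y, x) (β * (y + j), ((γ ^ e (y + j) : (ZMod q)ˣ) : ZMod q) * (x + i))) :
    ∃ S : Finset (ZMod p × ZMod q), S.card ≤ 5 ∧ ∀ v, ∃ s ∈ S, r s v := by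
  classical
  have hord : orderOf β = p - 1 := by
    rw [orderOf_eq_card_of_forall_mem_zpowers hβ, Nat.card_eq_fintype_card, ZMod.card_units]
  have hβ1 : 1 - (β : ZMod p) ≠ 0 := by
    intro h
    have : β = 1 := Units.ext (sub_eq_zero.1 h).symm
    rw [this, orderOf_one] at hord
    omega
  set y₀ : ZMod p := β * j / (1 - β) with hy₀
  have hfix : β * (y₀ + j) = y₀ := by rw [hy₀]; field_simp; ring
  have iter : ∀ (n : ℕ) (w : ZMod p), ∃ T, ∀ x, r (y₀ + w, x)
      (y₀ + ((β ^ n : (ZMod p)ˣ) : ZMod p) * w,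
        ((γ ^ ∑ l ∈ Finset.range n, e (y₀ + j + ((β ^ l : (ZMod p)ˣ) : ZMod p) * w) :
          (ZMod q)ˣ) : ZMod q) * x + T) := by
    intro n w
    induction n with
    | zero => exact ⟨0, fun x => by simp⟩
    | succ n ih =>
      obtain ⟨T, hT⟩ := ih
      set A := e (y₀ + j + ((β ^ n : (ZMod p)ˣ) : ZMod p) * w) with hA
      refine ⟨((γ ^ A : (ZMod q)ˣ) : ZMod q) * (T + i), fun x => r.trans (hT x) ?_⟩
      convert hr _ _ using 2
      · rw [pow_succ, Units.val_mul]
        linear_combination -hfix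
      · rw [Finset.sum_range_succ, add_comm _ (e _), zpow_add, Units.val_mul, ← hA,
          add_right_comm y₀ _ j, ← hA]
        ring
  obtain ⟨S₁, hS₁, h₁⟩ := exists_transversal_affine γ hγ (e (y₀ + j))
    (((γ ^ e (y₀ + j) : (ZMod q)ˣ) : ZMod q) * i) (r.comap (Prod.mk y₀)) (by
      intro x
      have := hr y₀ x
      rwa [hfix, mul_add] at this)
  obtain ⟨T, hT⟩ := iter (p - 1) 1
  have hE : ∑ z, e (y₀ + j + z) = ∑ z, e z :=
    Fintype.sum_equiv (Equiv.addLeft (y₀ + j)) _ _ fun _ => rfl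
  obtain ⟨S₂, hS₂, h₂⟩ := exists_transversal_affine γ hγ (∑ w, e w - e (y₀ + j)) T
    (r.comap (Prod.mk (y₀ + 1))) (by
      intro x
      have := hT x
      simp only [mul_one] at this
      rw [sum_range_pow_eq_sum_sub β hβ (fun w => e (y₀ + j + w)), ← hord, pow_orderOf_eq_one,
        add_zero, hE, Units.val_one] at this
      exact this)
  refine ⟨S₁.image (Prod.mk y₀) ∪ S₂.image (Prod.mk (y₀ + 1)), ?_, ?_⟩
  · have := Finset.card_union_le (S₁.image (Prod.mk y₀)) (S₂.image (Prod.mk (y₀ + 1)))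
    have := Finset.card_image_le (s := S₁) (f := Prod.mk y₀)
    have := Finset.card_image_le (s := S₂) (f := Prod.mk (y₀ + 1))
    have := he (y₀ + j)
    omega
  · rintro ⟨y, x⟩
    by_cases hy : y = y₀
    · obtain ⟨s, hs, h⟩ := h₁ x
      exact ⟨_, Finset.mem_union_left _ (Finset.mem_image_of_mem _ hs), hy ▸ h⟩
    · set w : (ZMod p)ˣ := Units.mk0 (y - y₀) (sub_ne_zero.2 hy) with hw
      obtain ⟨n, hn⟩ := mem_powers_iff_mem_zpowers.2 (hβ w⁻¹)
      obtain ⟨T', hT'⟩ := iter n w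
      have h := hT' x
      have hn' : β ^ n = w⁻¹ := hn
      have hy' : y₀ + (w : ZMod p) = y := by simp [hw]
      rw [hn', Units.inv_mul, hy'] at h
      obtain ⟨s, hs, hs'⟩ := h₂ _
      exact ⟨_, Finset.mem_union_right _ (Finset.mem_image_of_mem _ hs), r.trans hs' (r.symm h)⟩

theorem exists_exponents (p q : ℕ) [NeZero p] (hp : Odd p) (hp3 : 3 ≤ p) (hq : Odd q) (hq3 : 3 ≤ q) :
    ∃ e : ZMod p → ℤ,
      ∀ z, Int.gcd (e z) (q - 1) + Int.gcd (∑ w, e w - e z) (q - 1) ≤ 3 := by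
  obtain ⟨k, m, hm, hqm⟩ := Nat.exists_eq_two_pow_mul_odd (n := q - 1) (by omega)
  have hk : k ≠ 0 := by
    rintro rfl
    obtain ⟨a, ha⟩ := hq
    obtain ⟨b, hb⟩ := hm
    omega
  have hqz : (q : ℤ) - 1 = 2 ^ k * m := by
    have : ((q - 1 : ℕ) : ℤ) = 2 ^ k * m := by exact_mod_cast hqm
    rw [← this]; push_cast [show 1 ≤ q by omega]; ring
  let f : ℕ → ℤ := fun n => if n < 2 then m + 2 else if n = 2 then -m - 4
    else if Even n then 2 else -2
  obtain ⟨h, rfl⟩ : ∃ h, p = 2 * h + 3 := by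
    obtain ⟨a, ha⟩ := hp
    exact ⟨a - 1, by omega⟩
  have hsum : ∀ h : ℕ, ∑ n ∈ Finset.range (2 * h + 3), f n = m := by
    intro h
    induction h with
    | zero =>
      simp [Finset.sum_range_succ, f]
      ring
    | succ h ih =>
      have ho : ¬ Even (2 * h + 3) := by rw [Nat.even_iff]; omega
      have hev : Even (2 * h + 4) := by rw [Nat.even_iff]; omega
      rw [show 2 * (h + 1) + 3 = 2 * h + 3 + 1 + 1 by ring, Finset.sum_range_succ,
        Finset.sum_range_succ, ih]
      simp [f, ho, hev]
  have hm2 : IsCoprime (m : ℤ) 2 := by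
    rw [Int.isCoprime_iff_gcd_eq_one]
    exact Nat.Coprime.symm (Nat.coprime_two_left.2 hm)
  have one_of : ∀ a : ℤ, IsCoprime a 2 → IsCoprime a m → Int.gcd a (q - 1) = 1 := by
    intro a h2 hm
    rw [hqz, ← Int.isCoprime_iff_gcd_eq_one]
    exact (h2.pow_right).mul_right hm
  have two_of : ∀ a : ℤ, IsCoprime a 2 → IsCoprime a m → Int.gcd (2 * a) (q - 1) = 2 := by
    intro a h2 hm
    obtain ⟨k, rfl⟩ := Nat.exists_eq_succ_of_ne_zero hk
    rw [hqz, pow_succ', mul_assoc, Int.gcd_mul_left,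
      Int.isCoprime_iff_gcd_eq_one.1 ((h2.pow_right (n := k)).mul_right hm)]
    rfl
  have hE : ∑ z : ZMod (2 * h + 3), f z.val = m :=
    (Fin.sum_univ_eq_sum_range f (2 * h + 3)).trans (hsum h)
  have h4m : IsCoprime (-4 : ℤ) m := by
    have := (hm2.symm.mul_left hm2.symm).neg_left
    norm_num at this
    exact this
  have hadd2 : IsCoprime ((m : ℤ) + 2) 2 := by simpa using hm2.add_mul_left_left 1
  have haddm : IsCoprime ((m : ℤ) + 2) m := by
    simpa [add_comm] using hm2.symm.add_mul_left_left 1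
  have hsub2 : IsCoprime ((m : ℤ) - 2) 2 := by
    simpa [sub_eq_add_neg] using hm2.add_mul_left_left (-1)
  have hsubm : IsCoprime ((m : ℤ) - 2) m := by
    simpa [neg_add_eq_sub] using hm2.symm.neg_left.add_mul_left_left 1
  refine ⟨fun z => f z.val, fun z => ?_⟩
  rw [hE]
  simp only [f]
  split_ifs
  · rw [one_of _ hadd2 haddm, show (m : ℤ) - (m + 2) = 2 * (-1) by ring,
      two_of _ isCoprime_one_left.neg_left isCoprime_one_left.neg_left]
  · rw [one_of, show (m : ℤ) - (-m - 4) = 2 * (m + 2) by ring, two_of _ hadd2 haddm]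
    · have := hm2.neg_left.add_mul_left_left (-2)
      rwa [show -(m : ℤ) + 2 * -2 = -m - 4 by ring] at this
    · have := h4m.add_mul_left_left (-1)
      rwa [show -4 + (m : ℤ) * -1 = -m - 4 by ring] at this
  · rw [one_of _ hsub2 hsubm]
    have := two_of 1 isCoprime_one_left isCoprime_one_left
    rw [mul_one] at this
    rw [this]
  · have := two_of (-1) isCoprime_one_left.neg_left isCoprime_one_left.neg_left
    rw [mul_neg_one] at this
    rw [this, sub_neg_eq_add, one_of _ hadd2 haddm]

theorem exists_transversal_prime_sq {p : ℕ} [Fact p.Prime] (hp3 : 3 ≤ p)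
    (γ : (ZMod (p * p))ˣ) (hγ : ∀ w, w ∈ Subgroup.zpowers γ) (k : ZMod (p * p))
    (r : Setoid (ZMod (p * p))) (hr : ∀ x, r x (γ * (x + k))) :
    ∃ S : Finset (ZMod (p * p)), S.card ≤ 5 ∧ ∀ v, ∃ s ∈ S, r s v := by
  classical
  have hp : p.Prime := Fact.out
  have : NeZero (p * p) := ⟨mul_ne_zero hp.ne_zero hp.ne_zero⟩
  have isUnit_of : ∀ a : ℕ, ¬ p ∣ a → IsUnit (a : ZMod (p * p)) := by
    intro a ha
    have := (hp.coprime_iff_not_dvd.2 ha).symm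
    exact (ZMod.isUnit_iff_coprime _ _).2 (this.mul_right this)
  have hunit : IsUnit (1 - (γ : ZMod (p * p))) := by
    obtain ⟨a, ha⟩ := ZMod.natCast_zmod_surjective (1 - (γ : ZMod (p * p)))
    rw [← ha]
    refine isUnit_of a fun hdvd => ?_
    let φ := ZMod.castHom (Dvd.intro p rfl : p ∣ p * p) (ZMod p)
    have h1 : φ γ = 1 := by
      have := congrArg φ ha
      rw [map_natCast, (ZMod.natCast_eq_zero_iff _ _).2 hdvd, map_sub, map_one] at this
      exact (sub_eq_zero.1 this.symm).symm
    have h2 : Units.map (φ : ZMod (p * p) →* ZMod p) γ = 1 := Units.ext h1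
    obtain ⟨n, hn⟩ := hγ (-1)
    have h3 := congrArg (Units.map (φ : ZMod (p * p) →* ZMod p)) hn
    simp only [map_zpow, h2, one_zpow] at h3
    have h4 : (1 : ZMod p) = -1 := by simpa using congrArg Units.val h3
    have : Fact (2 < p) := ⟨hp3⟩
    exact ZMod.neg_one_ne_one h4.symm
  obtain ⟨v, hv⟩ := hunit
  set x₀ : ZMod (p * p) := ((v⁻¹ : (ZMod (p * p))ˣ) : ZMod (p * p)) * (γ * k) with hx₀
  have hfix : γ * (x₀ + k) = x₀ := by
    have h : (1 - (γ : ZMod (p * p))) * x₀ = γ * k := by rw [← hv, hx₀, Units.mul_inv_cancel_left]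
    linear_combination -h
  have hpow := (r.comap (x₀ + ·)).rel_smul_zpow γ (fun w => by
    have := hr (x₀ + w)
    rwa [show γ * (x₀ + w + k) = x₀ + γ • w by
      rw [Units.smul_def, smul_eq_mul]; linear_combination hfix] at this)
  have hmul : ∀ a : ℕ, ¬ p ∣ a → ∀ w : ZMod (p * p), r (x₀ + w) (x₀ + a * w) := by
    intro a ha w
    obtain ⟨u, hu⟩ := isUnit_of a ha
    obtain ⟨n, hn⟩ := hγ u
    have h : r (x₀ + w) (x₀ + γ ^ n • w) := hpow n w
    rw [show γ ^ n = u from hn, Units.smul_def, smul_eq_mul, hu] at h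
    exact h
  refine ⟨{x₀, x₀ + 1, x₀ + p}, Finset.card_le_three.trans (by norm_num), fun x => ?_⟩
  obtain ⟨a, ha⟩ := ZMod.natCast_zmod_surjective (x - x₀)
  have hx : x = x₀ + a := by rw [ha]; ring
  by_cases hpa : p ∣ a
  · obtain ⟨b, rfl⟩ := hpa
    by_cases hpb : p ∣ b
    · obtain ⟨c, rfl⟩ := hpb
      refine ⟨x₀, by simp, ?_⟩
      have : ((p * (p * c) : ℕ) : ZMod (p * p)) = 0 :=
        (ZMod.natCast_eq_zero_iff _ _).2 ⟨c, by ring⟩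
      rw [hx, this, add_zero]
    · refine ⟨x₀ + p, by simp, ?_⟩
      rw [hx, Nat.cast_mul, mul_comm (p : ZMod (p * p))]
      exact hmul b hpb p
  · refine ⟨x₀ + 1, by simp, ?_⟩
    have := hmul a hpa 1
    rwa [mul_one, ← hx] at this

theorem cyc_le_of_forall_setoid {α : Type*} (σ : Equiv.Perm α) (N : ℕ)
    (h : ∀ r : Setoid α, (∀ x, r x (σ x)) → ∃ S : Finset α, S.card ≤ N ∧ ∀ x, ∃ s ∈ S, r s x) :
    cyc σ ≤ N := by
  obtain ⟨S, hS, hcov⟩ := h (Setoid.mk σ.SameCycle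
    ⟨fun x => Equiv.Perm.SameCycle.refl σ x, fun h => h.symm, fun h h' => h.trans h'⟩)
    (fun x => ⟨1, by simp⟩)
  refine le_trans ?_ hS
  rw [← Nat.card_eq_finsetCard]
  refine Nat.card_le_card_of_surjective (fun s : S => Quotient.mk _ s.1) fun c => ?_
  obtain ⟨x, rfl⟩ := Quotient.exists_rep c
  obtain ⟨s, hs, h⟩ := hcov x
  exact ⟨⟨s, hs⟩, Quotient.sound h⟩

theorem sub_le_tCirc {n N : ℕ} (π : Equiv.Perm (ZMod n))
    (h : ∀ k, cyc (π * Equiv.addRight k) ≤ N) : n - N ≤ tCirc n := by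
  have hle : n - N ≤ tCoset π := by
    refine le_csInf ⟨_, 0, rfl⟩ ?_
    rintro _ ⟨k, rfl⟩
    exact Nat.sub_le_sub_left (h k) n
  refine hle.trans (le_csSup ⟨n, ?_⟩ ⟨π, rfl⟩)
  rintro _ ⟨π, rfl⟩
  have h0 : tCoset π ≤ tPerm (π * Equiv.addRight 0) := Nat.sInf_le ⟨0, rfl⟩
  exact h0.trans (Nat.sub_le _ _)

theorem tCirc_pq_ge (p q : ℕ) (hp : p.Prime) (hq : q.Prime) (hp3 : 3 ≤ p) (hq3 : 3 ≤ q) :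
    p * q - 5 ≤ tCirc (p * q) := by
  have := Fact.mk hp
  have := Fact.mk hq
  by_cases hpq : p = q
  · subst hpq
    have : IsCyclic (ZMod (p * p))ˣ := by
      rw [← sq]
      exact ZMod.isCyclic_units_of_prime_pow p hp (by omega) 2
    obtain ⟨γ, hγ⟩ := IsCyclic.exists_generator (α := (ZMod (p * p))ˣ)
    exact sub_le_tCirc γ.mulLeft fun k =>
      cyc_le_of_forall_setoid _ _ (exists_transversal_prime_sq hp3 γ hγ k)
  · obtain ⟨β, hβ⟩ := IsCyclic.exists_generator (α := (ZMod p)ˣ)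
    obtain ⟨γ, hγ⟩ := IsCyclic.exists_generator (α := (ZMod q)ˣ)
    obtain ⟨e, he⟩ := exists_exponents p q (hp.odd_of_ne_two (by omega)) hp3
      (hq.odd_of_ne_two (by omega)) hq3
    let φ := ZMod.chineseRemainder ((Nat.coprime_primes hp hq).2 hpq)
    refine sub_le_tCirc ((φ.toEquiv.trans
      (Equiv.prodShear β.mulLeft fun y => (γ ^ e y).mulLeft)).trans φ.symm.toEquiv)
      fun k => cyc_le_of_forall_setoid _ _ fun r hr => ?_
    obtain ⟨S, hS, h⟩ := exists_transversal_skew hp3 β hβ γ hγ e he (φ k).1 (φ k).2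
      (r.comap φ.symm) (by
        intro y x
        have := hr (φ.symm (y, x))
        simpa [Setoid.comap_rel] using this)
    refine ⟨S.map φ.symm.toEquiv.toEmbedding, by rwa [Finset.card_map], fun x => ?_⟩
    obtain ⟨s, hs, hs'⟩ := h (φ x)
    refine ⟨φ.symm s, Finset.mem_map_of_mem _ hs, ?_⟩
    simpa [Setoid.comap_rel] using hs'
end

section
/- Let p, q ≥ 3 be prime numbers such that q − 1 divides p − 1. Then t(pq) ≥ pq − 3. -/
open Finset

theorem cyc_le_three {α : Type*} (σ : Equiv.Perm α) (u v w : α)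
    (h : ∀ x, σ.SameCycle u x ∨ σ.SameCycle v x ∨ σ.SameCycle w x) : cyc σ ≤ 3 := by
  unfold cyc
  set s : Setoid α := Setoid.mk σ.SameCycle
    ⟨fun x => Equiv.Perm.SameCycle.refl σ x, fun h => h.symm, fun h h' => h.trans h'⟩
  have hsurj : Function.Surjective
      (fun i : Fin 3 => (Quotient.mk s (![u, v, w] i) : Quotient s)) := by
    intro c
    induction c using Quotient.inductionOn with
    | h x =>
      rcases h x with h | h | h
      · exact ⟨0, Quotient.sound h⟩
      · exact ⟨1, Quotient.sound h⟩
      · exact ⟨2, Quotient.sound h⟩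
  simpa using Nat.card_le_card_of_surjective _ hsurj

theorem le_tCirc {n : ℕ} (π : Equiv.Perm (ZMod n))
    (h : ∀ k : ZMod n, cyc (π * Equiv.addRight k) ≤ 3) : n - 3 ≤ tCirc n := by
  have hπ : n - 3 ≤ tCoset π := by
    refine le_csInf ⟨_, 0, rfl⟩ ?_
    rintro m ⟨k, rfl⟩
    have := h k
    unfold tPerm
    omega
  refine hπ.trans (le_csSup ⟨n, ?_⟩ ⟨π, rfl⟩)
  rintro m ⟨τ, rfl⟩
  have h0 : tCoset τ ≤ tPerm (τ * Equiv.addRight 0) := Nat.sInf_le ⟨0, rfl⟩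
  exact h0.trans (Nat.sub_le _ _)

theorem sum_units_eq_sum_range {G M : Type*} [Group G] [Fintype G] [AddCommMonoid M]
    {a : G} (ha : ∀ u, u ∈ Subgroup.zpowers a) (f : G → M) :
    ∑ u, f u = ∑ i ∈ range (orderOf a), f (a ^ i) := by
  classical
  rw [← IsCyclic.image_range_orderOf ha, sum_image]
  intro i hi j hj hij
  exact pow_injOn_Iio_orderOf (by simpa using hi) (by simpa using hj) hij

/-- A skew affine map over a one-dimensional affine map with multiplier a primitive root has at
most three cycles as soon as its first return map off the fixed fibre is a nonzero translation. -/
theorem cyc_le_three_of_skew_affine {p q : ℕ} [Fact p.Prime] [Fact q.Prime] {α : Type*}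
    (σ : Equiv.Perm α) (F : ZMod p × ZMod q → α) (hF : Function.Surjective F)
    (a : (ZMod p)ˣ) (g : (ZMod q)ˣ) (ha : ∀ u, u ∈ Subgroup.zpowers a)
    (hg : ∀ u, u ∈ Subgroup.zpowers g) (hg1 : (g : ZMod q) ≠ 1)
    (χ : (ZMod p)ˣ →* (ZMod q)ˣ) (hχ : χ a = g⁻¹)
    (x₀ : ZMod p) (e : ZMod p → ZMod q)
    (hσ : ∀ x y, σ (F (x₀ + x, y)) = F (x₀ + a * x, g * y + e x))
    (hne : ∑ u : (ZMod p)ˣ, (χ u : ZMod q) * e u ≠ 0) : cyc σ ≤ 3 := by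
  have hfix : ∀ (i : ℕ) (v : ZMod q),
      (σ ^ i) (F (x₀, e 0 / (1 - g) + v)) = F (x₀, e 0 / (1 - g) + g ^ i * v) := by
    intro i v
    induction i with
    | zero => rw [pow_zero, pow_zero, one_mul, Equiv.Perm.one_apply]
    | succ i ih =>
      have h1 : (1 - g : ZMod q) ≠ 0 := sub_ne_zero.2 hg1.symm
      have := hσ 0 (e 0 / (1 - g) + g ^ i * v)
      simp only [add_zero, mul_zero] at this
      rw [pow_succ', Equiv.Perm.mul_apply, ih, this]
      congr 2
      have h2 : e 0 / (1 - g) * (1 - g) = e 0 := div_mul_cancel₀ _ h1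
      linear_combination (-1 : ZMod q) * h2
  let S : ℕ → ZMod q := fun i => ∑ j ∈ range i, (g⁻¹ : (ZMod q)ˣ) ^ (j + 1) * e (a ^ j)
  have hiter : ∀ (i : ℕ) (y : ZMod q),
      (σ ^ i) (F (x₀ + 1, y)) = F (x₀ + a ^ i, g ^ i * (y + S i)) := by
    intro i y
    induction i with
    | zero => simp only [S, range_zero, sum_empty, pow_zero, one_mul, add_zero, Equiv.Perm.one_apply]
    | succ i ih =>
      rw [pow_succ', Equiv.Perm.mul_apply, ih, hσ, ← pow_succ']
      congr 2
      have h1 : (g : ZMod q) ^ (i + 1) * (g⁻¹ : (ZMod q)ˣ) ^ (i + 1) = 1 := by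
        rw [← mul_pow, Units.mul_inv, one_pow]
      simp only [S, sum_range_succ]
      linear_combination (-e (a ^ i)) * h1
  set N := orderOf a with hN
  have haN : (a : ZMod p) ^ N = 1 := by
    rw [← Units.val_pow_eq_pow_val, hN, pow_orderOf_eq_one, Units.val_one]
  have hgN : (g : ZMod q) ^ N = 1 := by
    have h1 : g ^ N = 1 := by
      rw [← inv_inj, ← inv_pow, ← hχ, ← map_pow, hN, pow_orderOf_eq_one, map_one, inv_one]
    rw [← Units.val_pow_eq_pow_val, h1, Units.val_one]
  have hS : S N ≠ 0 := by
    have h1 : S N = (g⁻¹ : (ZMod q)ˣ) * ∑ u : (ZMod p)ˣ, (χ u : ZMod q) * e u := by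
      rw [sum_units_eq_sum_range ha, mul_sum]
      refine sum_congr rfl fun i _ => ?_
      rw [map_pow, hχ]
      push_cast
      ring
    rw [h1]
    exact mul_ne_zero (Units.ne_zero _) hne
  have hret : ∀ (m : ℕ) (y : ZMod q),
      ((σ ^ N) ^ m) (F (x₀ + 1, y)) = F (x₀ + 1, y + m * S N) := by
    intro m y
    induction m with
    | zero => simp
    | succ m ih =>
      rw [pow_succ', Equiv.Perm.mul_apply, ih, hiter, haN, hgN]
      congr 2
      push_cast
      ring
  refine cyc_le_three σ (F (x₀, e 0 / (1 - g) + 0)) (F (x₀, e 0 / (1 - g) + 1))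
    (F (x₀ + 1, 0)) fun z => ?_
  obtain ⟨⟨x, y⟩, rfl⟩ := hF z
  by_cases hx : x = x₀
  · subst hx
    by_cases hy : y = e 0 / (1 - g)
    · left
      rw [hy, add_zero]
    · right; left
      obtain ⟨i, hi⟩ := mem_powers_iff_mem_zpowers.2
        (hg (Units.mk0 (y - e 0 / (1 - g)) (sub_ne_zero.2 hy)))
      refine ⟨i, ?_⟩
      rw [zpow_natCast, hfix]
      have h2 := congrArg Units.val hi
      simp only [Units.val_pow_eq_pow_val, Units.val_mk0] at h2
      rw [h2]
      congr 2
      ring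
  · right; right
    obtain ⟨i, hi⟩ := mem_powers_iff_mem_zpowers.2
      (ha (Units.mk0 (x - x₀) (sub_ne_zero.2 hx)))
    have h2 := congrArg Units.val hi
    simp only [Units.val_pow_eq_pow_val, Units.val_mk0] at h2
    have hgi : (g : ZMod q) ^ i ≠ 0 := pow_ne_zero _ (Units.ne_zero _)
    refine Equiv.Perm.SameCycle.trans (y := F (x₀ + 1, y / g ^ i - S i))
      ⟨((N * ((y / g ^ i - S i) / S N).val : ℕ) : ℤ), ?_⟩ ⟨i, ?_⟩
    · rw [zpow_natCast, pow_mul, hret, ZMod.natCast_zmod_val, div_mul_cancel₀ _ hS, zero_add]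
    · rw [zpow_natCast, hiter, h2, sub_add_cancel, mul_div_cancel₀ _ hgi]
      congr 2
      ring

theorem le_tCirc_of_fibration {p q : ℕ} [Fact p.Prime] [Fact q.Prime]
    (E : ZMod p × ZMod q ≃ ZMod (p * q)) (κ : ZMod (p * q) → ZMod p)
    (D : ZMod (p * q) → ZMod p → ZMod q)
    (hE : ∀ k x y, E (x, y) + k = E (x + κ k, y + D k x))
    (a : (ZMod p)ˣ) (g : (ZMod q)ˣ) (ha : ∀ u, u ∈ Subgroup.zpowers a)
    (hg : ∀ u, u ∈ Subgroup.zpowers g) (ha1 : (a : ZMod p) ≠ 1) (hg1 : (g : ZMod q) ≠ 1)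
    (χ : (ZMod p)ˣ →* (ZMod q)ˣ) (hχ : χ a = g⁻¹) (h : ZMod p → ZMod q)
    (hne : ∀ k z, κ k = (1 - a) * z →
      ∑ u : (ZMod p)ˣ, (χ u : ZMod q) * (g * D k (z - κ k + u) + h (z + u)) ≠ 0) :
    p * q - 3 ≤ tCirc (p * q) := by
  let φ : Equiv.Perm (ZMod p × ZMod q) :=
    Equiv.prodShear (Units.mulLeft a) fun x => (Units.mulLeft g).trans (Equiv.addRight (h x))
  have hφ : ∀ x y, φ (x, y) = (a * x, g * y + h x) := fun x y => rfl
  refine le_tCirc (E.symm.trans (φ.trans E)) fun k => ?_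
  have h1 : (1 - a : ZMod p) ≠ 0 := sub_ne_zero.2 ha1.symm
  obtain ⟨z, hz⟩ : ∃ z, κ k = (1 - a) * z := ⟨κ k / (1 - a), by field_simp⟩
  refine cyc_le_three_of_skew_affine _ E E.surjective a g ha hg hg1 χ hχ (z - κ k)
    (fun u => g * D k (z - κ k + u) + h (z + u)) (fun x y => ?_) (hne k z hz)
  simp only [Equiv.Perm.mul_apply, Equiv.coe_addRight, Equiv.trans_apply, hE,
    Equiv.symm_apply_apply, hφ]
  congr 2
  · rw [hz]; ring
  · rw [show z - κ k + x + κ k = z + x by ring]; ring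

theorem exists_generator_ne_one {p : ℕ} [Fact p.Prime] (hp3 : 3 ≤ p) :
    ∃ a : (ZMod p)ˣ, (∀ u, u ∈ Subgroup.zpowers a) ∧ (a : ZMod p) ≠ 1 := by
  obtain ⟨a, ha⟩ := IsCyclic.exists_generator (α := (ZMod p)ˣ)
  refine ⟨a, ha, fun h => ?_⟩
  have : Fact (2 < p) := ⟨hp3⟩
  have h1 : a = 1 := Units.ext h
  have h2 := ha (-1)
  rw [h1, Subgroup.zpowers_one_eq_bot, Subgroup.mem_bot] at h2
  exact ZMod.neg_one_ne_one (congrArg Units.val h2)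

theorem sum_units_eq_sum {K M : Type*} [Field K] [Fintype K] [DecidableEq K] [AddCommMonoid M]
    (f : K → M) (h0 : f 0 = 0) : ∑ u : Kˣ, f u = ∑ x, f x := by
  refine Fintype.sum_of_injective (fun u : Kˣ => (u : K)) Units.val_injective _ _ ?_ fun _ => rfl
  intro x hx
  by_contra hne
  exact hx ⟨Units.mk0 x fun h => hne (h ▸ h0), rfl⟩

theorem sum_mulChar_mul_inv_add {K R : Type*} [Field K] [Fintype K] [DecidableEq K] [CommRing R]
    [IsDomain R] {X : MulChar K R} (hX : X ≠ 1) (w : K) :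
    ∑ u, X u * X⁻¹ (w + u) = if w = 0 then (Fintype.card K : R) - 1 else -1 := by
  split_ifs with hw
  · subst hw
    simp only [zero_add, ← MulChar.mul_apply, mul_inv_cancel]
    rw [MulChar.sum_one_eq_card_units, Fintype.card_units, Nat.cast_sub Fintype.card_pos,
      Nat.cast_one]
  · have hw' : -w ≠ 0 := neg_ne_zero.2 hw
    have h1 : X w * X⁻¹ w = 1 := by
      rw [← MulChar.mul_apply, mul_inv_cancel, MulChar.one_apply (Ne.isUnit hw)]
    have h2 : X (-1) * X (-1) = 1 := by rw [← map_mul]; simp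
    rw [← Equiv.sum_comp (Equiv.mulLeft₀ (-w) hw')]
    have h3 : ∀ t, X (Equiv.mulLeft₀ (-w) hw' t) * X⁻¹ (w + Equiv.mulLeft₀ (-w) hw' t) =
        X (-1) * (X t * X⁻¹ (1 - t)) := by
      intro t
      change X (-w * t) * X⁻¹ (w + -w * t) = _
      rw [show -w * t = -1 * (w * t) by ring,
        show w + -1 * (w * t) = w * (1 - t) by ring, map_mul, map_mul, map_mul]
      linear_combination (X (-1) * X t * X⁻¹ (1 - t)) * h1
    simp only [h3]
    rw [← mul_sum, ← jacobiSum, jacobiSum_nontrivial_inv hX]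
    linear_combination -h2

theorem le_tCirc_mul_of_ne {p q : ℕ} [Fact p.Prime] [Fact q.Prime] (hp3 : 3 ≤ p) (hq3 : 3 ≤ q)
    (hdvd : (q - 1) ∣ (p - 1)) (hpq : p ≠ q) : p * q - 3 ≤ tCirc (p * q) := by
  obtain ⟨a, ha, ha1⟩ := exists_generator_ne_one hp3
  obtain ⟨g, hg, hg1⟩ := exists_generator_ne_one hq3
  have hord : orderOf g⁻¹ ∣ orderOf a := by
    rw [orderOf_inv, orderOf_eq_card_of_forall_mem_zpowers ha,
      orderOf_eq_card_of_forall_mem_zpowers hg, Nat.card_eq_fintype_card,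
      Nat.card_eq_fintype_card, ZMod.card_units, ZMod.card_units]
    exact hdvd
  let χ := monoidHomOfForallMemZpowers ha hord
  have hχ : χ a = g⁻¹ := monoidHomOfForallMemZpowers_apply_gen ha hord
  let X : MulChar (ZMod p) (ZMod q) := MulChar.ofUnitHom χ
  have hXu : ∀ u : (ZMod p)ˣ, (χ u : ZMod q) = X u := fun u => (MulChar.ofUnitHom_coe χ u).symm
  have hX : X ≠ 1 := by
    intro h
    have h1 := hXu a
    rw [h, MulChar.one_apply_coe, hχ] at h1
    exact hg1 (congrArg Units.val (inv_eq_one.1 (Units.ext h1)))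
  have hcop : p.Coprime q := (Nat.coprime_primes Fact.out Fact.out).2 hpq
  have hp0 : (p : ZMod q) ≠ 0 := by
    rw [Ne, ZMod.natCast_eq_zero_iff]
    exact fun h => hpq ((Nat.prime_dvd_prime_iff_eq Fact.out Fact.out).1 h).symm
  have h2 : (2 : ZMod q) ≠ 0 := by
    have : Fact (2 < q) := ⟨hq3⟩
    exact Ring.two_ne_zero (by rw [ZMod.ringChar_zmod_n]; omega)
  obtain ⟨α, β, hαβ, hα, hβ⟩ : ∃ α β : ZMod q, α + β = p ∧ α ≠ 1 ∧ β ≠ 1 := by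
    by_cases hp1 : (p : ZMod q) = 1
    · refine ⟨-1, 2, by rw [hp1]; ring, fun h => h2 ?_, fun h => one_ne_zero (α := ZMod q) ?_⟩
      · linear_combination -h
      · linear_combination h
    · exact ⟨0, p, zero_add _, zero_ne_one, hp1⟩
  let C := ZMod.chineseRemainder hcop
  refine le_tCirc_of_fibration C.symm.toEquiv (fun k => (C k).1) (fun k _ => (C k).2) ?_
    a g ha hg ha1 hg1 χ hχ (fun x => α * X⁻¹ x + β * X⁻¹ (x - 1)) ?_
  · intro k x y
    apply C.injective
    simp
    rfl
  · intro k z _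
    simp only [hXu]
    rw [sum_units_eq_sum (fun u => X u *
      (g * (C k).2 + (α * X⁻¹ (z + u) + β * X⁻¹ (z + u - 1)))) (by simp only [X.map_zero, zero_mul])]
    have h3 : ∀ u, X u * (g * (C k).2 + (α * X⁻¹ (z + u) + β * X⁻¹ (z + u - 1))) =
        (g * (C k).2) * X u + α * (X u * X⁻¹ (z + u)) + β * (X u * X⁻¹ (z - 1 + u)) := by
      intro u
      rw [show z + u - 1 = z - 1 + u by ring]
      ring
    simp only [h3, sum_add_distrib, ← mul_sum, MulChar.sum_eq_zero_of_ne_one hX,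
      sum_mulChar_mul_inv_add hX, ZMod.card, sub_eq_zero]
    by_cases hz0 : z = 0
    · subst hz0
      simp only [if_true, zero_ne_one, if_false]
      intro h
      refine mul_ne_zero hp0 (sub_ne_zero.2 hα) ?_
      linear_combination h + hαβ
    by_cases hz1 : z = 1
    · subst hz1
      simp only [if_true, one_ne_zero, if_false]
      intro h
      refine mul_ne_zero hp0 (sub_ne_zero.2 hβ) ?_
      linear_combination h + hαβ
    · simp only [hz0, hz1, if_false]
      intro h
      refine hp0 ?_
      linear_combination -h - hαβ

theorem sum_zmod_ite_val_lt {p : ℕ} [NeZero p] {M : Type*} [AddCommMonoid M] {n : ℕ} (hn : n ≤ p)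
    (f : ZMod p → M) : ∑ w, (if w.val < n then f w else 0) = ∑ i ∈ range n, f i := by
  rw [← sum_filter]
  refine sum_nbij' ZMod.val (fun i => (i : ZMod p)) (fun w hw => by simpa using hw)
    (fun i hi => ?_) (fun w _ => ZMod.natCast_zmod_val w) (fun i hi => ?_)
    (fun w _ => by rw [ZMod.natCast_zmod_val])
  · have hi := mem_range.1 hi
    simpa [ZMod.val_natCast_of_lt (hi.trans_le hn)] using hi
  · exact ZMod.val_natCast_of_lt ((mem_range.1 hi).trans_le hn)

theorem two_mul_sum_zmod_ite_val_lt {p : ℕ} [NeZero p] {n : ℕ} (hn : n ≤ p) (z : ZMod p) :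
    2 * ∑ w : ZMod p, (if w.val < n then w - z else 0) = n * (n - 1) - 2 * z * n := by
  rw [sum_zmod_ite_val_lt hn]
  clear hn
  induction n with
  | zero => simp
  | succ n ih =>
    rw [sum_range_succ, mul_add, ih]
    push_cast
    ring

/-- The map `(x, y) ↦ x + p * y` on the digits in base `p`. -/
def ofDigitPair (p : ℕ) (x : ZMod p × ZMod p) : ZMod (p * p) := (x.1.val + p * x.2.val : ℕ)

theorem ofDigitPair_add {p : ℕ} [Fact p.Prime] (x y k l : ZMod p) :
    ofDigitPair p (x, y) + ofDigitPair p (k, l) =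
      ofDigitPair p (x + k, y + (l + if (x + k).val < k.val then 1 else 0)) := by
  have hmul : ∀ s t : ZMod p, ((p * (s + t).val : ℕ) : ZMod (p * p)) =
      (p * s.val : ℕ) + (p * t.val : ℕ) := by
    intro s t
    rw [← Nat.cast_add, ← mul_add, ZMod.natCast_eq_natCast_iff, ZMod.val_add]
    exact (Nat.mod_modEq _ _).mul_left' p
  have hcarry : ((x.val : ℕ) : ZMod (p * p)) + (k.val : ℕ) = ((x + k).val : ℕ) +
      (p * (if (x + k).val < k.val then (1 : ZMod p) else 0).val : ℕ) := by
    have hx := x.val_lt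
    have hk := k.val_lt
    rcases lt_or_ge (x.val + k.val) p with h | h
    · rw [ZMod.val_add_of_lt h, if_neg (by omega)]
      simp
    · have h1 := ZMod.val_add_val_of_le h
      rw [if_pos (by omega), ← Nat.cast_add, h1]
      rw [ZMod.val_one]
      push_cast
      ring
  simp only [ofDigitPair, Nat.cast_add, hmul]
  linear_combination hcarry

theorem ofDigitPair_bijective (p : ℕ) [NeZero p] : Function.Bijective (ofDigitPair p) := by
  rw [Fintype.bijective_iff_surjective_and_card]
  refine ⟨fun z => ⟨((z.val : ℕ), (z.val / p : ℕ)), ?_⟩, by simp [ZMod.card]⟩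
  have hz : z.val / p < p := Nat.div_lt_of_lt_mul z.val_lt
  rw [ofDigitPair, ZMod.val_natCast, ZMod.val_natCast_of_lt hz, Nat.mod_add_div,
    ZMod.natCast_zmod_val]

theorem le_tCirc_mul_self {p : ℕ} [Fact p.Prime] (hp3 : 3 ≤ p) : p * p - 3 ≤ tCirc (p * p) := by
  obtain ⟨a, ha, ha1⟩ := exists_generator_ne_one hp3
  have h2 : (2 : ZMod p) ≠ 0 := Ring.two_ne_zero (by rw [ZMod.ringChar_zmod_n]; omega)
  let g : (ZMod p)ˣ := a⁻¹
  let E := Equiv.ofBijective _ (ofDigitPair_bijective p)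
  obtain ⟨d, hd⟩ : ∃ d : ZMod p, ∀ z : ZMod p, d + g * (a ^ 2 - 1) * z ^ 2 ≠ 0 := by
    by_cases hc : (g * (a ^ 2 - 1) : ZMod p) = 0
    · exact ⟨1, fun z => by simp [hc]⟩
    · obtain ⟨s, hs⟩ := FiniteField.exists_nonsquare (F := ZMod p)
        (by rw [ZMod.ringChar_zmod_n]; omega)
      refine ⟨-(g * (a ^ 2 - 1) * s), fun z hz => hs ⟨z, mul_left_cancel₀ hc ?_⟩⟩
      linear_combination -hz
  obtain ⟨β, hβ⟩ : ∃ β, 2 * β = d := ⟨d / 2, mul_div_cancel₀ _ h2⟩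
  obtain ⟨α, hα⟩ : ∃ α, 2 * (α + β) = -(g * (1 - a) : ZMod p) :=
    ⟨-(g * (1 - a) : ZMod p) / 2 - β, by rw [sub_add_cancel, mul_div_cancel₀ _ h2]⟩
  refine le_tCirc_of_fibration E (fun k => (E.symm k).1)
    (fun k x => (E.symm k).2 + if (x + (E.symm k).1).val < (E.symm k).1.val then 1 else 0) ?_
    a g ha (fun u => by rw [Subgroup.zpowers_inv]; exact ha u) ha1
    (fun h => ha1 (congrArg Units.val (inv_eq_one.1 (Units.ext h : a⁻¹ = 1)))) (MonoidHom.id _)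
    (inv_inv a).symm (fun w => (if w = 0 then α else 0) + if w = 1 then β else 0) ?_
  · intro k x y
    obtain ⟨⟨k₀, k₁⟩, rfl⟩ := E.surjective k
    simp only [Equiv.symm_apply_apply]
    exact ofDigitPair_add x y k₀ k₁
  · intro k z hz
    obtain ⟨⟨k₀, k₁⟩, rfl⟩ := E.surjective k
    simp only [Equiv.symm_apply_apply, MonoidHom.id_apply] at hz ⊢
    rw [sum_units_eq_sum (fun u => u * (g * (k₁ + if (z - k₀ + u + k₀).val < k₀.val then 1 else 0) +
      ((if z + u = 0 then α else 0) + if z + u = 1 then β else 0))) (by simp),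
      ← (Equiv.subRight z).sum_comp]
    have hsplit : ∀ w, Equiv.subRight z w *
        (g * (k₁ + if (z - k₀ + Equiv.subRight z w + k₀).val < k₀.val then 1 else 0) +
        ((if z + Equiv.subRight z w = 0 then α else 0) +
          if z + Equiv.subRight z w = 1 then β else 0)) =
        g * k₁ * (if w.val < p then w - z else 0) +
        g * (if w.val < k₀.val then w - z else 0) +
        ((if w = 0 then (w - z) * α else 0) + if w = 1 then (w - z) * β else 0) := by
      intro w
      rw [Equiv.subRight_apply, show z - k₀ + (w - z) + k₀ = w by ring,
        show z + (w - z) = w by ring, if_pos w.val_lt]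
      split_ifs <;> ring
    simp only [hsplit, sum_add_distrib, ← mul_sum, sum_ite_eq', mem_univ, if_true]
    have h3 := two_mul_sum_zmod_ite_val_lt le_rfl z
    have h4 := two_mul_sum_zmod_ite_val_lt k₀.val_lt.le z
    rw [ZMod.natCast_self] at h3
    rw [ZMod.natCast_zmod_val] at h4
    intro h
    apply hd z
    subst hz
    linear_combination 2 * h - g * k₁ * h3 - g * h4 - hβ + z * hα

theorem tCirc_pq_ge_of_dvd (p q : ℕ) (hp : p.Prime) (hq : q.Prime) (hp3 : 3 ≤ p) (hq3 : 3 ≤ q)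
    (hdvd : (q - 1) ∣ (p - 1)) :
    p * q - 3 ≤ tCirc (p * q) := by
  have : Fact p.Prime := ⟨hp⟩
  have : Fact q.Prime := ⟨hq⟩
  rcases eq_or_ne p q with rfl | hpq
  · exact le_tCirc_mul_self hp3
  · exact le_tCirc_mul_of_ne hp3 hq3 hdvd hpq
end

section
/- Let p be an odd prime. Then t(3p) = 3p − 3. -/
theorem cyc_le_three_of_iterate {α : Type*} (σ : Equiv.Perm α) (a b c : α)
    (h : ∀ x, ∃ m : ℕ, σ^[m] a = x ∨ σ^[m] b = x ∨ σ^[m] c = x) : cyc σ ≤ 3 := by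
  have key : ∀ (y x : α) (m : ℕ), σ^[m] y = x → σ.SameCycle y x := fun y x m hm =>
    ⟨m, by rw [zpow_natCast, ← Equiv.Perm.iterate_eq_pow, hm]⟩
  unfold cyc
  rw [← Nat.card_fin 3]
  refine Nat.card_le_card_of_surjective (fun i : Fin 3 => Quotient.mk _ (![a, b, c] i)) ?_
  intro q
  induction q using Quotient.inductionOn with
  | _ x =>
    obtain ⟨m, hm | hm | hm⟩ := h x
    exacts [⟨0, Quotient.sound (key _ _ m hm)⟩, ⟨1, Quotient.sound (key _ _ m hm)⟩,
      ⟨2, Quotient.sound (key _ _ m hm)⟩]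

theorem three_le_cyc {α : Type*} [Finite α] (σ : Equiv.Perm α) {a b c : α}
    (hab : ¬ σ.SameCycle a b) (hac : ¬ σ.SameCycle a c) (hbc : ¬ σ.SameCycle b c) :
    3 ≤ cyc σ := by
  unfold cyc
  rw [← Nat.card_fin 3]
  refine Nat.card_le_card_of_injective (fun i : Fin 3 => Quotient.mk _ (![a, b, c] i)) ?_
  intro i j hij
  have hs : σ.SameCycle (![a, b, c] i) (![a, b, c] j) := Quotient.exact hij
  have hs' := hs.symm
  fin_cases i <;> fin_cases j <;> simp_all

theorem not_sameCycle_of_mapsTo {α : Type*} [Finite α] {σ : Equiv.Perm α} {s : Set α}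
    (hs : Set.MapsTo σ s s) {x y : α} (hx : x ∈ s) (hy : y ∉ s) : ¬ σ.SameCycle x y := by
  intro h
  obtain ⟨m, -, rfl⟩ := h.exists_pow_eq'
  rw [← Equiv.Perm.iterate_eq_pow] at hy
  exact hy (hs.iterate m hx)

theorem two_mul_sum_sq_eq_zero {n : ℕ} [NeZero n] (f : Equiv.Perm (ZMod n))
    (hsub : Function.Injective fun x => f x - x) (hadd : Function.Injective fun x => f x + x) :
    2 * ∑ x : ZMod n, x ^ 2 = 0 := by
  have h1 := Fintype.sum_bijective _ (Finite.injective_iff_bijective.mp hsub)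
    (fun x => (f x - x) ^ 2) (fun x => x ^ 2) fun _ => rfl
  have h2 := Fintype.sum_bijective _ (Finite.injective_iff_bijective.mp hadd)
    (fun x => (f x + x) ^ 2) (fun x => x ^ 2) fun _ => rfl
  have h3 := Fintype.sum_bijective _ f.bijective (fun x => f x ^ 2) (fun x => x ^ 2) fun _ => rfl
  have h4 : ∑ x, (f x - x) ^ 2 + ∑ x, (f x + x) ^ 2 = 2 * ∑ x, f x ^ 2 + 2 * ∑ x, x ^ 2 := by
    simp only [Finset.mul_sum, ← Finset.sum_add_distrib]
    exact Finset.sum_congr rfl fun x _ => by ring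
  rw [h1, h2, h3] at h4
  linear_combination -h4

theorem two_mul_sum_sq_ne_zero {p : ℕ} [NeZero (3 * p)] :
    2 * ∑ x : ZMod (3 * p), x ^ 2 ≠ 0 := by
  have hsum : ∀ n : ℕ, 6 * ∑ i ∈ Finset.range n, (i : ℤ) ^ 2 = n * (n - 1) * (2 * n - 1) := by
    intro n
    induction n with
    | zero => simp
    | succ n ih => rw [Finset.sum_range_succ, mul_add, ih]; push_cast; ring
  have hcast : ∑ x : ZMod (3 * p), x ^ 2 =
      ((∑ i ∈ Finset.range (3 * p), (i : ℤ) ^ 2 : ℤ) : ZMod (3 * p)) := by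
    push_cast
    refine Finset.sum_bij' (fun x _ => x.val) (fun i _ => (i : ZMod (3 * p))) ?_ ?_ ?_ ?_ ?_
    · simp [ZMod.val_lt]
    · simp
    · simp
    · intro i hi
      exact ZMod.val_cast_of_lt (Finset.mem_range.mp hi)
    · simp
  have hp : (p : ℤ) ≠ 0 := by
    have := NeZero.ne (3 * p)
    exact_mod_cast fun h => this (by simp [h])
  intro h
  rw [hcast] at h
  have h' : ((2 * ∑ i ∈ Finset.range (3 * p), (i : ℤ) ^ 2 : ℤ) : ZMod (3 * p)) = 0 := by
    exact_mod_cast h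
  rw [ZMod.intCast_zmod_eq_zero_iff_dvd] at h'
  obtain ⟨d, hd⟩ := h'
  have h6 := hsum (3 * p)
  push_cast at hd h6
  have h7 : (p : ℤ) * (3 * (3 * d)) = p * (3 * ((3 * p - 1) * (6 * p - 1))) := by
    linear_combination h6 - 3 * hd
  have h8 : 3 * (d - 6 * p ^ 2 + 3 * p) = (1 : ℤ) := by
    have := mul_left_cancel₀ (three_ne_zero) (mul_left_cancel₀ hp h7)
    linear_combination this
  omega

theorem exists_three_le_cyc {p : ℕ} (hp : 2 ≤ p) (π : Equiv.Perm (ZMod (3 * p))) :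
    ∃ k, 3 ≤ cyc (π * Equiv.addRight k) := by
  have : NeZero (3 * p) := ⟨by omega⟩
  by_contra! hcon
  have hcard : ∀ a b c : ZMod (3 * p), ∃ z, z ≠ a ∧ z ≠ b ∧ z ≠ c := by
    intro a b c
    obtain ⟨z, hz⟩ := Finset.exists_mem_notMem_of_card_lt_card
      (s := {a, b, c}) (t := (Finset.univ : Finset (ZMod (3 * p)))) (by
        rw [Finset.card_univ, ZMod.card]
        exact Finset.card_le_three.trans_lt (by omega))
    exact ⟨z, by simpa using hz.2⟩
  have happ : ∀ k x, (π * Equiv.addRight k) x = π (x + k) := fun k x => rfl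
  have hfix : ∀ k x, π⁻¹ x - x = k → (π * Equiv.addRight k) x = x := by
    rintro _ x rfl
    simp [happ]
  have hsub : Function.Injective fun x => π⁻¹ x - x := by
    intro x y hxy
    by_contra hne
    obtain ⟨z, hzx, hzy, -⟩ := hcard x y y
    have hx := hfix _ x rfl
    have hy := hfix (π⁻¹ x - x) y hxy.symm
    refine (hcon (π⁻¹ x - x)).not_ge (three_le_cyc _ (a := x) (b := y) (c := z) ?_ ?_ ?_)
    · exact not_sameCycle_of_mapsTo (s := {x}) (Set.mapsTo_singleton.mpr hx) rfl (Ne.symm hne)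
    · exact not_sameCycle_of_mapsTo (s := {x}) (Set.mapsTo_singleton.mpr hx) rfl hzx
    · exact not_sameCycle_of_mapsTo (s := {y}) (Set.mapsTo_singleton.mpr hy) rfl hzy
  have hadd : Function.Injective fun x => π⁻¹ x + x := by
    intro x y hxy
    by_contra hne
    obtain ⟨w, hw⟩ := (Finite.injective_iff_bijective.mp hsub).surjective (π⁻¹ x - y)
    have hwf := hfix _ w hw
    have hy : (π * Equiv.addRight (π⁻¹ x - y)) y = x := by simp [happ]
    have hx : (π * Equiv.addRight (π⁻¹ x - y)) x = y := by
      have : x + (π⁻¹ x - y) = π⁻¹ y := by linear_combination hxy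
      rw [happ, this]
      exact π.apply_symm_apply y
    have hwx : w ≠ x := by
      rintro rfl
      exact hne (hwf.symm.trans hx)
    have hwy : w ≠ y := by
      rintro rfl
      exact hne (hy.symm.trans hwf)
    obtain ⟨z, hzx, hzy, hzw⟩ := hcard x y w
    refine (hcon (π⁻¹ x - y)).not_ge (three_le_cyc _ (a := w) (b := x) (c := z) ?_ ?_ ?_)
    · exact not_sameCycle_of_mapsTo (s := {w}) (Set.mapsTo_singleton.mpr hwf) rfl hwx.symm
    · exact not_sameCycle_of_mapsTo (s := {w}) (Set.mapsTo_singleton.mpr hwf) rfl hzw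
    · refine not_sameCycle_of_mapsTo (s := {x, y}) ?_ (by simp) (by simp [hzx, hzy])
      rintro _ (rfl | rfl)
      · exact Or.inr hx
      · exact Or.inl hy
  exact two_mul_sum_sq_ne_zero (two_mul_sum_sq_eq_zero π⁻¹ hsub hadd)

theorem sum_quadraticChar_sub_mul_sub {F : Type*} [Field F] [Fintype F] [DecidableEq F]
    (hF : ringChar F ≠ 2) (x w : F) :
    ∑ y, quadraticChar F (y - x) * quadraticChar F (y - w) =
      if x = w then (Fintype.card F : ℤ) - 1 else -1 := by
  split_ifs with h
  · subst h
    rw [← Equiv.sum_comp (Equiv.addRight x)]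
    simp only [Equiv.coe_addRight, add_sub_cancel_right]
    rw [← Finset.add_sum_erase _ _ (Finset.mem_univ (0 : F)), Finset.sum_congr rfl
      (g := fun _ => (1 : ℤ)) fun y hy => by
        rw [← sq]; exact quadraticChar_sq_one (Finset.ne_of_mem_erase hy)]
    simp [Finset.card_erase_of_mem, Nat.cast_sub Fintype.card_pos]
  · have hwx : w - x ≠ 0 := sub_ne_zero.mpr (Ne.symm h)
    have hj := jacobiSum_nontrivial_inv (quadraticChar_ne_one hF)
    rw [(quadraticChar_isQuadratic F).inv, jacobiSum] at hj
    rw [← Equiv.sum_comp ((Equiv.mulLeft₀ (w - x) hwx).trans (Equiv.addRight x))]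
    have hterm : ∀ z : F, quadraticChar F ((w - x) * z + x - x) *
        quadraticChar F ((w - x) * z + x - w) =
        quadraticChar F (-1) * (quadraticChar F z * quadraticChar F (1 - z)) := by
      intro z
      have e1 : (w - x) * z + x - x = (w - x) * z := by ring
      have e2 : (w - x) * z + x - w = (w - x) * (-1 * (1 - z)) := by ring
      rw [e1, e2, map_mul, map_mul, map_mul]
      linear_combination (quadraticChar F (-1) * quadraticChar F z * quadraticChar F (1 - z)) *
        quadraticChar_sq_one hwx
    refine (Finset.sum_congr rfl fun z _ => hterm z).trans ?_
    rw [← Finset.mul_sum, hj]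
    linear_combination -quadraticChar_sq_one (F := F) (a := -1) (by simp)

/-- Some `ℤ/3`-valued function on `ℤ/p` correlates with every translate of the quadratic
character. -/
theorem exists_forall_sum_quadraticChar_mul_ne_zero {p : ℕ} [Fact p.Prime] (h2 : p ≠ 2)
    (h3 : p ≠ 3) : ∃ s : ZMod p → ZMod 3,
      ∀ w, ∑ y, (quadraticChar (ZMod p) y : ZMod 3) * s (w + y) ≠ 0 := by
  have hF : ringChar (ZMod p) ≠ 2 := by rwa [ZMod.ringChar_zmod_n]
  have hcorr : ∀ w a : ZMod p, ∑ y, (quadraticChar (ZMod p) y : ZMod 3) *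
      (quadraticChar (ZMod p) (w + y - a) : ZMod 3) = if w = a then (p : ZMod 3) - 1 else -1 := by
    intro w a
    have h := sum_quadraticChar_sub_mul_sub hF w a
    rw [← Equiv.sum_comp (Equiv.addLeft w)] at h
    simp only [Equiv.coe_addLeft, add_sub_cancel_left, ZMod.card] at h
    have h' := congrArg (Int.cast : ℤ → ZMod 3) h
    push_cast at h'
    exact h'
  have hp3 : (p : ZMod 3) ≠ 0 := by
    rw [Ne, ZMod.natCast_eq_zero_iff, Nat.prime_dvd_prime_iff_eq Nat.prime_three Fact.out]
    exact Ne.symm h3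
  by_cases hp : (p : ZMod 3) = 1
  · refine ⟨fun y => (quadraticChar (ZMod p) (y - 0) : ZMod 3) +
      (quadraticChar (ZMod p) (y - 1) : ZMod 3), fun w => ?_⟩
    simp only [mul_add, Finset.sum_add_distrib, hcorr, hp]
    have h01 : (0 : ZMod p) ≠ 1 := zero_ne_one
    split_ifs with h h'
    · exact absurd (h.symm.trans h') h01
    all_goals decide
  · refine ⟨fun y => (quadraticChar (ZMod p) (y - 0) : ZMod 3), fun w => ?_⟩
    rw [hcorr]
    generalize (p : ZMod 3) = q at *
    split_ifs
    · exact sub_ne_zero.mpr hp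
    · decide

theorem skew_iterate {R S : Type*} [CommRing R] [CommRing S] (s : R → S) (g w : R) (i a : S)
    (f : S × R → S × R)
    (hf : ∀ a y, f (a, g * w + y) = (-a - i + s (w + y), g * w + g * y)) (m : ℕ) :
    f^[m] (a, g * w + 1) = ((-1) ^ m * (a - ∑ j ∈ Finset.range m, (-1) ^ j * (s (w + g ^ j) - i)),
      g * w + g ^ m) := by
  induction m with
  | zero => simp
  | succ m ih =>
    rw [Function.iterate_succ_apply', ih, hf, Finset.sum_range_succ]
    have : ((-1 : S) ^ m) ^ 2 = 1 := by rw [← pow_mul, mul_comm, pow_mul]; simp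
    ext
    · dsimp only
      linear_combination -(s (w + g ^ m) - i) * this
    · dsimp only
      ring

theorem exists_skew_perm {p : ℕ} [Fact p.Prime] (h2 : p ≠ 2) (h3 : p ≠ 3) :
    ∃ F : Equiv.Perm (ZMod 3 × ZMod p), ∀ v, ∃ A B C, ∀ z, ∃ m : ℕ,
      (fun y => F (y + v))^[m] A = z ∨ (fun y => F (y + v))^[m] B = z ∨
        (fun y => F (y + v))^[m] C = z := by
  have hF : ringChar (ZMod p) ≠ 2 := by rwa [ZMod.ringChar_zmod_n]
  obtain ⟨s, hs⟩ := exists_forall_sum_quadraticChar_mul_ne_zero h2 h3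
  obtain ⟨g, hg⟩ := IsCyclic.exists_generator (α := (ZMod p)ˣ)
  have hord : orderOf g = p - 1 := by
    rw [orderOf_eq_card_of_forall_mem_zpowers hg, Nat.card_eq_fintype_card, ZMod.card_units]
  have hχg : quadraticChar (ZMod p) g = -1 := by
    rw [quadraticChar_eq_neg_one_iff_not_one g.ne_zero]
    intro h1
    obtain ⟨u, hu⟩ := quadraticChar_exists_neg_one' hF
    obtain ⟨m, rfl⟩ := Submonoid.mem_powers_iff _ _ |>.mp (mem_powers_iff_mem_zpowers.mpr (hg u))
    rw [Units.val_pow_eq_pow_val, map_pow, h1, one_pow] at hu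
    norm_num at hu
  have hpow : ∀ y : ZMod p, y ≠ 0 → ∃ m : ℕ, (g : ZMod p) ^ m = y := by
    intro y hy
    obtain ⟨m, hm⟩ := Submonoid.mem_powers_iff _ _ |>.mp
      (mem_powers_iff_mem_zpowers.mpr (hg (Units.mk0 y hy)))
    exact ⟨m, by simpa using congrArg Units.val hm⟩
  have heven : Even (p - 1) := (Fact.out : p.Prime).even_sub_one h2
  have hsum : ∀ w, ∑ j ∈ Finset.range (p - 1), (-1 : ZMod 3) ^ j * s (w + (g : ZMod p) ^ j) ≠ 0 := by
    intro w
    convert hs w using 1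
    symm
    rw [← Finset.add_sum_erase _ _ (Finset.mem_univ (0 : ZMod p))]
    simp only [quadraticChar_zero, Int.cast_zero, zero_mul, zero_add]
    symm
    refine Finset.sum_bij (fun j _ => (g : ZMod p) ^ j) ?_ ?_ ?_ ?_
    · intro j _
      simp
    · intro j hj l hl hjl
      rw [Finset.mem_range, ← hord] at hj hl
      exact pow_injOn_Iio_orderOf hj hl (Units.ext (by simpa using hjl))
    · intro y hy
      obtain ⟨m, hm⟩ := hpow y (Finset.ne_of_mem_erase hy)
      refine ⟨m % orderOf g, ?_, ?_⟩
      · rw [Finset.mem_range, ← hord]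
        exact Nat.mod_lt _ (orderOf_pos g)
      · rw [← hm, ← Units.val_pow_eq_pow_val, pow_mod_orderOf, Units.val_pow_eq_pow_val]
    · intro j _
      rw [map_pow, hχg]
      push_cast
      rfl
  have hinj : Function.Injective fun z : ZMod 3 × ZMod p => (-z.1 + s z.2, (g : ZMod p) * z.2) := by
    rintro ⟨a, x⟩ ⟨b, y⟩ h
    obtain ⟨h₁, h₂⟩ := Prod.ext_iff.mp h
    obtain rfl : x = y := mul_left_cancel₀ g.ne_zero h₂
    simpa using h₁
  refine ⟨Equiv.ofBijective _ (Finite.injective_iff_bijective.mp hinj), ?_⟩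
  rintro ⟨i, k⟩
  set f : ZMod 3 × ZMod p → ZMod 3 × ZMod p := fun y => Equiv.ofBijective _
    (Finite.injective_iff_bijective.mp hinj) (y + (i, k)) with hfdef
  have hg1 : (g : ZMod p) - 1 ≠ 0 := by
    intro h
    rw [sub_eq_zero.mp h, map_one] at hχg
    norm_num at hχg
  obtain ⟨w, hw⟩ : ∃ w : ZMod p, g * w + k = w := by
    refine ⟨-k / (g - 1), ?_⟩
    field_simp
    ring
  have hf : ∀ a y, f (a, g * w + y) = (-a - i + s (w + y), g * w + g * y) := by
    intro a y
    have : g * w + y + k = w + y := by linear_combination hw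
    simp only [hfdef, Equiv.ofBijective_apply, Prod.mk_add_mk, this]
    ext
    · dsimp only
      ring
    · dsimp only
      ring
  have hiter := skew_iterate s (g : ZMod p) w i (f := f) (hf := hf)
  have halt : ∑ j ∈ Finset.range (p - 1), (-1 : ZMod 3) ^ j * i = 0 := by
    rw [← Finset.sum_mul, neg_one_geom_sum, if_pos heven, zero_mul]
  set T := ∑ j ∈ Finset.range (p - 1), (-1 : ZMod 3) ^ j * s (w + (g : ZMod p) ^ j) with hT
  have hmono : ∀ a, f^[p - 1] (a, g * w + 1) = (a - T, g * w + 1) := by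
    intro a
    have hgp : (g : ZMod p) ^ (p - 1) = 1 := ZMod.pow_card_sub_one_eq_one g.ne_zero
    rw [hiter, hgp, heven.neg_one_pow, one_mul]
    simp only [mul_sub, Finset.sum_sub_distrib, halt, sub_zero, hT]
  have hfiber : ∀ l : ℕ, f^[(p - 1) * l] (0, g * w + 1) = (-(l * T), g * w + 1) := by
    intro l
    induction l with
    | zero => simp
    | succ l ih =>
      rw [Nat.mul_succ, add_comm, Function.iterate_add_apply, ih, hmono]
      ext
      · push_cast
        ring
      · rfl
  set d := s w - i with hd
  have hfix : ∀ a, f (a, g * w) = (d - a, g * w) := by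
    intro a
    have := hf a 0
    simp only [add_zero, mul_zero] at this
    rw [this, hd]
    ext
    · dsimp only
      ring
    · rfl
  refine ⟨(0, g * w + 1), (-d, g * w), (-d + 1, g * w), ?_⟩
  rintro ⟨b, x⟩
  obtain ⟨y, rfl⟩ : ∃ y, x = g * w + y := ⟨x - g * w, by ring⟩
  by_cases hy : y = 0
  · subst hy
    have h3 : (3 : ZMod 3) = 0 := rfl
    have hcases : ∀ c : ZMod 3, c = 0 ∨ c = 1 ∨ c = -1 := by decide
    rw [add_zero]
    rcases hcases (b + d) with h | h | h
    · exact ⟨0, Or.inr (Or.inl (by rw [← eq_neg_of_add_eq_zero_left h]; rfl))⟩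
    · refine ⟨0, Or.inr (Or.inr (Prod.ext ?_ rfl))⟩
      simp only [Function.iterate_zero, id]
      linear_combination -h
    · refine ⟨1, Or.inr (Or.inr ?_)⟩
      rw [Function.iterate_one, hfix]
      refine Prod.ext ?_ rfl
      dsimp only
      linear_combination -h + d * h3
  · obtain ⟨m, rfl⟩ := hpow y hy
    obtain ⟨a, ha⟩ : ∃ a, f^[m] (a, g * w + 1) = (b, g * w + g ^ m) := by
      have hm : ((-1 : ZMod 3) ^ m) ^ 2 = 1 := by rw [← pow_mul, mul_comm, pow_mul]; simp
      refine ⟨(-1) ^ m * b + ∑ j ∈ Finset.range m, (-1) ^ j * (s (w + g ^ j) - i), ?_⟩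
      rw [hiter]
      refine Prod.ext ?_ rfl
      dsimp only
      linear_combination b * hm
    refine ⟨m + (p - 1) * (-a / T).val, Or.inl ?_⟩
    rw [Function.iterate_add_apply, hfiber, ZMod.natCast_zmod_val, div_mul_cancel₀ _ (hsum w),
      neg_neg, ha]

theorem exists_forall_cyc_le_three_of_ne_three {p : ℕ} (hp : p.Prime) (h2 : p ≠ 2) (h3 : p ≠ 3) :
    ∃ π : Equiv.Perm (ZMod (3 * p)), ∀ k, cyc (π * Equiv.addRight k) ≤ 3 := by
  have := Fact.mk hp
  obtain ⟨F, hF⟩ := exists_skew_perm h2 h3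
  let e := ZMod.chineseRemainder ((Nat.coprime_primes Nat.prime_three hp).mpr h3.symm)
  refine ⟨(e.toEquiv.trans F).trans e.symm.toEquiv, fun k => ?_⟩
  obtain ⟨A, B, C, h⟩ := hF (e k)
  set σ : Equiv.Perm (ZMod (3 * p)) :=
    (e.toEquiv.trans F).trans e.symm.toEquiv * Equiv.addRight k
  have hsemi : Function.Semiconj e.symm (fun y => F (y + e k)) σ := by
    intro y
    change _ = e.symm (F (e (e.symm y + k)))
    simp
  refine cyc_le_three_of_iterate _ (e.symm A) (e.symm B) (e.symm C) fun x => ?_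
  obtain ⟨m, hm⟩ := h (e x)
  refine ⟨m, ?_⟩
  simp only [← (hsemi.iterate_right m).eq, e.symm_apply_eq]
  exact hm

theorem exists_forall_cyc_le_three_nine :
    ∃ π : Equiv.Perm (ZMod 9), ∀ k, cyc (π * Equiv.addRight k) ≤ 3 := by
  let v : Fin 9 → Fin 9 := ![0, 1, 3, 4, 6, 2, 8, 5, 7]
  have hv : Function.Bijective v := by decide
  have h : ∀ k x : Fin 9, ∃ m : Fin 9, (fun y => v (y + k))^[m] 0 = x ∨
      (fun y => v (y + k))^[m] (![1, 2, 1, 2, 0, 0, 0, 6, 3] k) = x ∨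
      (fun y => v (y + k))^[m] (![2, 7, 5, 3, 0, 0, 0, 8, 4] k) = x := by
    decide +kernel
  refine ⟨(Equiv.ofBijective v hv : Equiv.Perm (Fin 9)), fun k => ?_⟩
  refine cyc_le_three_of_iterate _ (0 : Fin 9) ((![1, 2, 1, 2, 0, 0, 0, 6, 3] : Fin 9 → Fin 9) k)
    ((![2, 7, 5, 3, 0, 0, 0, 8, 4] : Fin 9 → Fin 9) k) fun x => ?_
  obtain ⟨m, hm⟩ := h k x
  exact ⟨m, hm⟩

theorem exists_forall_cyc_le_three {p : ℕ} (hp : p.Prime) (h2 : p ≠ 2) :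
    ∃ π : Equiv.Perm (ZMod (3 * p)), ∀ k, cyc (π * Equiv.addRight k) ≤ 3 := by
  by_cases h3 : p = 3
  · subst h3
    exact exists_forall_cyc_le_three_nine
  · exact exists_forall_cyc_le_three_of_ne_three hp h2 h3

theorem tCirc_three_mul_prime (p : ℕ) (hp : p.Prime) (hodd : Odd p) :
    tCirc (3 * p) = 3 * p - 3 := by
  have hle : ∀ π : Equiv.Perm (ZMod (3 * p)), tCoset π ≤ 3 * p - 3 := by
    intro π
    obtain ⟨k, hk⟩ := exists_three_le_cyc hp.two_le π
    have hk' : tCoset π ≤ tPerm (π * Equiv.addRight k) := Nat.sInf_le ⟨k, rfl⟩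
    exact hk'.trans (Nat.sub_le_sub_left hk _)
  obtain ⟨π, hπ⟩ := exists_forall_cyc_le_three hp (by rintro rfl; exact absurd hodd (by decide))
  have hge : 3 * p - 3 ≤ tCoset π := by
    refine le_csInf ⟨_, 0, rfl⟩ ?_
    rintro _ ⟨k, rfl⟩
    exact Nat.sub_le_sub_left (hπ k) _
  refine le_antisymm (csSup_le ⟨_, 1, rfl⟩ ?_) (hge.trans (le_csSup ⟨3 * p - 3, ?_⟩ ⟨π, rfl⟩))
  all_goals
    rintro _ ⟨π, rfl⟩
    exact hle π
end

section
/- Let m, n ≥ 2 be integers. Then c_poly(mn) ≥ c_poly(n) + 1. -/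
/-- `c_poly(n)`: the minimum, over all permutations `π` of `ℤ_n` that are induced by a
polynomial with coefficients in `ℤ_n`, of the maximum over `k ∈ ℤ_n` of the number of
cycles of the cyclic shift `x ↦ π (x + k)`. -/
noncomputable def cPoly (n : ℕ) : ℕ :=
  sInf { m : ℕ | ∃ π : Equiv.Perm (ZMod n),
    (∃ f : Polynomial (ZMod n), ∀ a : ZMod n, π a = f.eval a) ∧
    m = sSup { m' : ℕ | ∃ k : ZMod n, m' = cyc (π * Equiv.addRight k) } }

/-- If an injection intertwines `ρ` with `σ` and its range misses a point, then `σ` has more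
cycles than `ρ`. -/
theorem cyc_add_one_le_of_semiconj {α β : Type*} [Finite β] {ρ : Equiv.Perm α}
    {σ : Equiv.Perm β} {ι : α → β} (hι : Function.Injective ι)
    (hσ : ∀ a, σ (ι a) = ι (ρ a)) {b : β} (hb : ∀ a, ι a ≠ b) :
    cyc ρ + 1 ≤ cyc σ := by
  have hpow : ∀ (z : ℤ) (a : α), (σ ^ z) (ι a) = ι ((ρ ^ z) a) := by
    intro z
    induction z using Int.induction_on with
    | zero => simp
    | succ i ih =>
      intro a
      rw [zpow_add_one, zpow_add_one, Equiv.Perm.mul_apply, Equiv.Perm.mul_apply, hσ, ih]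
    | pred i ih =>
      intro a
      rw [zpow_sub_one, zpow_sub_one, Equiv.Perm.mul_apply, Equiv.Perm.mul_apply, ← ih]
      congr 1
      rw [Equiv.Perm.inv_eq_iff_eq, hσ, Equiv.Perm.inv_def, Equiv.apply_symm_apply]
  have : Finite α := Finite.of_injective ι hι
  unfold cyc
  rw [← Finite.card_option]
  refine Nat.card_le_card_of_injective
    (fun o => o.elim (Quotient.mk _ b) (Quotient.map ι ?_)) ?_
  · rintro s t ⟨z, hz⟩
    exact ⟨z, by rw [hpow, hz]⟩
  · have hne (s : α) : ¬ σ.SameCycle (ι s) b := by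
      rintro ⟨z, hz⟩
      exact hb _ ((hpow z s).symm.trans hz)
    rintro (_ | x) (_ | y) h
    · rfl
    · induction y using Quotient.inductionOn with
      | h s => exact (hne s (Quotient.exact h.symm)).elim
    · induction x using Quotient.inductionOn with
      | h s => exact (hne s (Quotient.exact h)).elim
    · induction x using Quotient.inductionOn with
      | h s =>
        induction y using Quotient.inductionOn with
        | h t =>
          obtain ⟨z, hz⟩ : σ.SameCycle (ι s) (ι t) := Quotient.exact h
          rw [hpow] at hz
          exact congrArg some (Quotient.sound ⟨z, hι hz⟩)

theorem bddAbove_cyc_mul_addRight {n : ℕ} [NeZero n] (π : Equiv.Perm (ZMod n)) :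
    BddAbove { m' : ℕ | ∃ k : ZMod n, m' = cyc (π * Equiv.addRight k) } :=
  ((Set.finite_range fun k : ZMod n => cyc (π * Equiv.addRight k)).subset
    (by rintro _ ⟨k, rfl⟩; exact ⟨k, rfl⟩)).bddAbove

/-- Some cyclic shift of a polynomial permutation of `ℤ_n` has at least `c_poly(n)` cycles. -/
theorem exists_cPoly_le_cyc {n : ℕ} [NeZero n] (π : Equiv.Perm (ZMod n))
    (f : Polynomial (ZMod n)) (hf : ∀ a, π a = f.eval a) :
    ∃ k : ZMod n, cPoly n ≤ cyc (π * Equiv.addRight k) := by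
  have hne : { m' : ℕ | ∃ k : ZMod n, m' = cyc (π * Equiv.addRight k) }.Nonempty := ⟨_, 0, rfl⟩
  obtain ⟨k, hk⟩ := Nat.sSup_mem hne (bddAbove_cyc_mul_addRight π)
  exact ⟨k, hk ▸ Nat.sInf_le ⟨π, ⟨f, hf⟩, rfl⟩⟩

/-- A lower bound for the number of cycles of some shift of each polynomial permutation is a
lower bound for `c_poly(n)`. -/
theorem le_cPoly {n c : ℕ} [NeZero n]
    (h : ∀ (π : Equiv.Perm (ZMod n)) (f : Polynomial (ZMod n)), (∀ a, π a = f.eval a) →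
      ∃ k : ZMod n, c ≤ cyc (π * Equiv.addRight k)) :
    c ≤ cPoly n := by
  refine le_csInf ⟨_, 1, ⟨Polynomial.X, by simp⟩, rfl⟩ ?_
  rintro _ ⟨π, ⟨f, hf⟩, rfl⟩
  obtain ⟨k, hk⟩ := h π f hf
  exact hk.trans (le_csSup (bddAbove_cyc_mul_addRight π) ⟨k, rfl⟩)

/-- Multiplication by `m`, as a homomorphism from `ℤ_n` to `ℤ_{mn}`. -/
def ZMod.mulLeftHom (m n : ℕ) : ZMod n →+ ZMod (m * n) :=
  ZMod.lift n ⟨zmultiplesHom (ZMod (m * n)) m, by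
    rw [zmultiplesHom_apply, natCast_zsmul, nsmul_eq_mul, mul_comm, ← Nat.cast_mul,
      ZMod.natCast_self]⟩

theorem ZMod.mulLeftHom_intCast (m n : ℕ) (a : ℤ) :
    ZMod.mulLeftHom m n a = (m : ZMod (m * n)) * a := by
  rw [ZMod.mulLeftHom, ZMod.lift_coe, zmultiplesHom_apply, zsmul_eq_mul]
  exact mul_comm _ _

theorem ZMod.mulLeftHom_injective {m : ℕ} (n : ℕ) (hm : m ≠ 0) :
    Function.Injective (ZMod.mulLeftHom m n) := by
  rw [injective_iff_map_eq_zero]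
  intro t ht
  obtain ⟨a, rfl⟩ := ZMod.intCast_surjective t
  rw [ZMod.mulLeftHom_intCast, ← Int.cast_natCast, ← Int.cast_mul,
    ZMod.intCast_zmod_eq_zero_iff_dvd, Nat.cast_mul] at ht
  rw [ZMod.intCast_zmod_eq_zero_iff_dvd]
  exact Int.dvd_of_mul_dvd_mul_left (by exact_mod_cast hm) ht

theorem ZMod.mulLeftHom_ne_one {m : ℕ} (n : ℕ) (hm : m ≠ 1) (t : ZMod n) :
    ZMod.mulLeftHom m n t ≠ 1 := by
  obtain ⟨a, rfl⟩ := ZMod.intCast_surjective t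
  intro h
  have h' := congrArg (ZMod.castHom (dvd_mul_right m n) (ZMod m)) h
  rw [ZMod.mulLeftHom_intCast, map_mul, map_natCast, ZMod.natCast_self, zero_mul, map_one] at h'
  have := (ZMod.nontrivial_iff (n := m)).2 hm
  exact zero_ne_one h'

theorem ZMod.castHom_mulLeftHom (m n : ℕ) (t : ZMod n) :
    ZMod.castHom (dvd_mul_left n m) (ZMod n) (ZMod.mulLeftHom m n t) = m * t := by
  obtain ⟨a, rfl⟩ := ZMod.intCast_surjective t
  rw [ZMod.mulLeftHom_intCast, map_mul, map_natCast, map_intCast]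

theorem ZMod.mulLeftHom_mul_castHom (m n : ℕ) (t : ZMod n) (y : ZMod (m * n)) :
    ZMod.mulLeftHom m n (t * ZMod.castHom (dvd_mul_left n m) (ZMod n) y) =
      ZMod.mulLeftHom m n t * y := by
  obtain ⟨a, rfl⟩ := ZMod.intCast_surjective t
  obtain ⟨b, rfl⟩ := ZMod.intCast_surjective y
  rw [map_intCast, ← Int.cast_mul, ZMod.mulLeftHom_intCast, ZMod.mulLeftHom_intCast,
    Int.cast_mul, mul_assoc]

open Polynomial in
/-- A polynomial over `ℤ_{mn}` vanishing at `0` acts on the multiples of `m` as a polynomial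
over `ℤ_n`. -/
theorem ZMod.exists_mulLeftHom_eval (m n : ℕ) (g : (ZMod (m * n))[X]) (hg : g.eval 0 = 0) :
    ∃ G : (ZMod n)[X], ∀ t,
      ZMod.mulLeftHom m n (G.eval t) = g.eval (ZMod.mulLeftHom m n t) := by
  obtain ⟨q, rfl⟩ : X ∣ g := by rwa [X_dvd_iff, coeff_zero_eq_eval_zero]
  refine ⟨X * (q.map (ZMod.castHom (dvd_mul_left n m) (ZMod n))).comp (C (m : ZMod n) * X),
    fun t => ?_⟩
  rw [eval_mul, eval_X, eval_comp, eval_mul, eval_C, eval_X, ← ZMod.castHom_mulLeftHom,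
    eval_map_apply, ZMod.mulLeftHom_mul_castHom, eval_mul, eval_X]

theorem cPoly_mul_ge_succ (m n : ℕ) (hm : 2 ≤ m) (hn : 2 ≤ n) :
    cPoly n + 1 ≤ cPoly (m * n) := by
  have : NeZero m := ⟨by omega⟩
  have : NeZero n := ⟨by omega⟩
  refine le_cPoly fun π f hf => ?_
  set k₀ := π.symm 0 with hk₀
  obtain ⟨G, hG⟩ := ZMod.exists_mulLeftHom_eval m n
    (f.comp (Polynomial.X + Polynomial.C k₀)) (by simp [← hf, hk₀])
  simp only [Polynomial.eval_comp, Polynomial.eval_add, Polynomial.eval_X, Polynomial.eval_C,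
    ← hf] at hG
  have hι := ZMod.mulLeftHom_injective n (NeZero.ne m)
  have hinj : Function.Injective fun t => G.eval t := by
    intro s t hst
    have h := congrArg (ZMod.mulLeftHom m n) hst
    simp only [hG] at h
    exact hι (add_right_cancel (π.injective h))
  obtain ⟨h, hh⟩ := exists_cPoly_le_cyc
    (Equiv.ofBijective _ (Finite.injective_iff_bijective.1 hinj)) G fun _ => rfl
  refine ⟨ZMod.mulLeftHom m n h + k₀, (Nat.succ_le_succ hh).trans <|
    cyc_add_one_le_of_semiconj hι (fun t => ?_) (ZMod.mulLeftHom_ne_one n (by omega))⟩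
  simp [hG, add_assoc]
end
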